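/- arXiv:2411.08151 — 2 statements merged into one kernel-verified Lean document; each statement's English description precedes it below -/
import Mathlib

section
/- There is a constant C ≥ 1 such that for every integer n ≥ 2, every n-vertex directed unweighted graph G, and every set P of p demand pairs in the transitive closure of G, there exists an exact distance preserver H of (G,P) with |E(H)| ≤ C·(n^{5/6}·p^{2/3}·(log n)^C + n). -/
open Finset

/-- A walk in a directed edge set `F`, given as the list of visited vertices. -/
def IsWalkOn {V : Type} (F : Finset (V × V)) (s t : V) (l : List V) : Prop :=
  l.Chain' (fun a b => (a, b) ∈ F) ∧ l.head? = some s ∧ l.getLast? = some t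

def ReachableOn {V : Type} (F : Finset (V × V)) (s t : V) : Prop :=
  ∃ l, IsWalkOn F s t l

/-- A directed weighted graph: a finite set of directed edges together with weights. -/
structure WDigraph (V : Type) where
  Edge : Finset (V × V)
  w : V × V → ℝ

namespace WDigraph

variable {V : Type}

/-- Total weight of a walk (sum of weights of consecutive pairs). -/
def walkWeight (G : WDigraph V) (l : List V) : ℝ :=
  ((l.zip l.tail).map G.w).sum

/-- Distance from `s` to `t` using only edges of `F`, with weights of `G`. -/
noncomputable def distOn (G : WDigraph V) (F : Finset (V × V)) (s t : V) : ℝ :=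
  sInf {x | ∃ l, IsWalkOn F s t l ∧ G.walkWeight l = x}

def IsWalk (G : WDigraph V) (s t : V) (l : List V) : Prop :=
  IsWalkOn G.Edge s t l

def Reachable (G : WDigraph V) (s t : V) : Prop :=
  ReachableOn G.Edge s t

noncomputable def dist (G : WDigraph V) (s t : V) : ℝ :=
  G.distOn G.Edge s t

/-- All edge weights equal to `1`. -/
def Unweighted (G : WDigraph V) : Prop := ∀ e ∈ G.Edge, G.w e = 1

/-- All edge weights positive. -/
def PosWeights (G : WDigraph V) : Prop := ∀ e ∈ G.Edge, 0 < G.w e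

/-- `F` is (the edge set of) an exact distance preserver of `(G, P)`. -/
def IsExactPreserver (G : WDigraph V) (F : Finset (V × V)) (P : Finset (V × V)) : Prop :=
  F ⊆ G.Edge ∧ ∀ q ∈ P, ReachableOn F q.1 q.2 ∧ G.distOn F q.1 q.2 = G.dist q.1 q.2

/-- Total (in plus out) degree of a vertex. -/
def degree [DecidableEq V] (G : WDigraph V) (v : V) : ℕ :=
  (G.Edge.filter fun e => e.1 = v ∨ e.2 = v).card

end WDigraph

/-- Distances of a directed graph in which shortest paths are unique: `pred x y` is the vertex
preceding `y` on the shortest path from `x` to `y`. -/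
structure GeodesicSystem (V : Type) where
  d : V → V → ℕ
  pred : V → V → V
  d_self : ∀ x, d x x = 0
  d_pos : ∀ {x y}, x ≠ y → 0 < d x y
  triangle : ∀ x y z, d x z ≤ d x y + d y z
  pred_ne : ∀ {x y}, x ≠ y → pred x y ≠ y
  pred_between : ∀ {x y}, x ≠ y → d x (pred x y) + d (pred x y) y = d x y
  pred_eq : ∀ {s x y}, d s x + d x y = d s y → x ≠ y → pred s y = pred x y

namespace GeodesicSystem

variable {V : Type} (D : GeodesicSystem V)

/-- The vertex `y` lies on the shortest path of the pair `q`. -/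
def On (q : V × V) (y : V) : Prop := D.d q.1 y + D.d y q.2 = D.d q.1 q.2

/-- The vertex `x` lies on the shortest path from the source of `q` to `y`. -/
def Before (q : V × V) (x y : V) : Prop := D.d q.1 x + D.d x y = D.d q.1 y

/-- The length of the shortest closed walk through `x` and `y`. -/
def round (x y : V) : ℕ := D.d x y + D.d y x

variable {D}

theorem before_refl (q : V × V) (x : V) : D.Before q x x := by
  simp [Before, D.d_self]

theorem round_comm (x y : V) : D.round x y = D.round y x := Nat.add_comm _ _

theorem Before.trans_d {q : V × V} {x y z : V} (hxy : D.Before q x y) (hyz : D.Before q y z) :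
    D.d x z = D.d x y + D.d y z := by
  have h1 := D.triangle x y z
  have h2 := D.triangle q.1 x z
  simp only [Before] at hxy hyz
  omega

theorem Before.antisymm {q : V × V} {x y : V} (hxy : D.Before q x y) (hyx : D.Before q y x) :
    x = y := by
  by_contra h
  have := D.d_pos h
  simp only [Before] at *
  omega

theorem linear {s x y z : V} (hx : D.d s x + D.d x z = D.d s z)
    (hy : D.d s y + D.d y z = D.d s z) :
    D.d s x + D.d x y = D.d s y ∨ D.d s y + D.d y x = D.d s x := by
  induction hN : D.d s z using Nat.strong_induction_on generalizing z with
  | _ N ih =>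
    by_cases hxz : x = z
    · subst hxz; exact Or.inr hy
    by_cases hyz : y = z
    · subst hyz; exact Or.inl hx
    have hsz : s ≠ z := by
      rintro rfl
      have := D.d_pos hxz
      have := D.d_self s
      omega
    have ex := D.pred_eq hx hxz
    have ey := D.pred_eq hy hyz
    have bs := D.pred_between hsz
    have bx := D.pred_between hxz
    have hby := D.pred_between hyz
    rw [← ex] at bx
    rw [← ey] at hby
    have hpos := D.d_pos (D.pred_ne hsz)
    have tx := D.triangle s x (D.pred s z)
    have ty := D.triangle s y (D.pred s z)
    exact ih (D.d s (D.pred s z)) (by omega) (z := D.pred s z) (by omega) (by omega) rfl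

theorem On.before_total {q : V × V} {x y : V} (hx : D.On q x) (hy : D.On q y) :
    D.Before q x y ∨ D.Before q y x :=
  linear hx hy

variable (D) in
/-- Incidences between vertices and the pairs whose shortest paths enter them, such that
different pairs enter a common vertex through different edges. -/
structure IsIncidence (J : Finset (V × (V × V))) : Prop where
  on : ∀ {y q}, (y, q) ∈ J → D.On q y
  pred_ne : ∀ {y q q'}, (y, q) ∈ J → (y, q') ∈ J → q ≠ q' → D.pred q.1 y ≠ D.pred q'.1 y

namespace IsIncidence

variable {J : Finset (V × (V × V))}

theorem mono {J' : Finset (V × (V × V))} (hJ : D.IsIncidence J) (h : J' ⊆ J) :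
    D.IsIncidence J' :=
  ⟨fun m => hJ.on (h m), fun m m' => hJ.pred_ne (h m) (h m')⟩

theorem not_before (hJ : D.IsIncidence J) {q q' : V × V} {x y : V} (hq : q ≠ q') (hxy : x ≠ y)
    (hy : (y, q) ∈ J) (hy' : (y, q') ∈ J) (h : D.Before q x y) : ¬ D.Before q' x y := by
  intro h'
  exact hJ.pred_ne hy hy' hq ((D.pred_eq h hxy).trans (D.pred_eq h' hxy).symm)

theorem before_swap (hJ : D.IsIncidence J) {q q' : V × V} {x y : V} (hq : q ≠ q')
    (hx' : (x, q') ∈ J) (hy : (y, q) ∈ J) (hy' : (y, q') ∈ J)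
    (h : D.Before q x y) : D.Before q' y x := by
  by_cases hxy : x = y
  · subst hxy; exact before_refl _ _
  exact ((hJ.on hx').before_total (hJ.on hy')).resolve_left (hJ.not_before hq hxy hy hy' h)

theorem round_le_of_before (hJ : D.IsIncidence J) {σ σ' : V × V} {x x' y y' : V} (hσ : σ ≠ σ')
    (hy : (y, σ) ∈ J) (hy' : (y', σ) ∈ J) (ky : (y, σ') ∈ J) (ky' : (y', σ') ∈ J)
    (hx : D.Before σ y x) (hx' : D.Before σ y' x)
    (kx : D.Before σ' y x') (kx' : D.Before σ' y' x') :
    D.round y y' ≤ D.round x x' := by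
  wlog h : D.Before σ y y' generalizing y y'
  · rw [round_comm]
    exact this hy' hy ky' ky hx' hx kx' kx
      (((hJ.on hy).before_total (hJ.on hy')).resolve_left h)
  have h' := hJ.before_swap hσ ky hy' ky' h
  have e1 := h.trans_d hx'
  have e2 := h'.trans_d kx
  have t1 := D.triangle y x' x
  have t2 := D.triangle y' x x'
  simp only [round]
  omega

theorem round_le_of_after (hJ : D.IsIncidence J) {σ σ' : V × V} {x x' y y' : V} (hσ : σ ≠ σ')
    (hy : (y, σ) ∈ J) (hy' : (y', σ) ∈ J) (ky : (y, σ') ∈ J) (ky' : (y', σ') ∈ J)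
    (hx : D.Before σ x y) (hx' : D.Before σ x y')
    (kx : D.Before σ' x' y) (kx' : D.Before σ' x' y') :
    D.round y y' ≤ D.round x x' := by
  wlog h : D.Before σ y y' generalizing y y'
  · rw [round_comm]
    exact this hy' hy ky' ky hx' hx kx' kx
      (((hJ.on hy).before_total (hJ.on hy')).resolve_left h)
  have h' := hJ.before_swap hσ ky hy' ky' h
  have e1 := hx.trans_d h
  have e2 := kx'.trans_d h'
  have t1 := D.triangle x x' y'
  have t2 := D.triangle x' x y
  simp only [round]
  omega

/-- Three distinct pairs have at most one common vertex. -/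
theorem eq_of_three (hJ : D.IsIncidence J) {q₁ q₂ q₃ : V × V} {x y : V}
    (h12 : q₁ ≠ q₂) (h13 : q₁ ≠ q₃) (h23 : q₂ ≠ q₃)
    (x1 : (x, q₁) ∈ J) (x2 : (x, q₂) ∈ J) (x3 : (x, q₃) ∈ J)
    (y1 : (y, q₁) ∈ J) (y2 : (y, q₂) ∈ J) (y3 : (y, q₃) ∈ J) : x = y := by
  wlog h : D.Before q₁ x y generalizing x y
  · exact (this y1 y2 y3 x1 x2 x3
      (((hJ.on x1).before_total (hJ.on y1)).resolve_left h)).symm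
  have h2 := hJ.before_swap h12 x2 y1 y2 h
  have h3 := hJ.before_swap h13 x3 y1 y3 h
  have h3' := hJ.before_swap h23 y3 x2 x3 h2
  exact h3'.antisymm h3

end IsIncidence

end GeodesicSystem

section Counting

variable {V ι : Type*} [Fintype V] [DecidableEq V]

/-- Finite sets with small pairwise intersections have small total size. -/
theorem sq_sum_card_le_of_card_inter_le (s : Finset ι) (A : ι → Finset V) (κ : ℕ)
    (h : ∀ i ∈ s, ∀ j ∈ s, i ≠ j → #(A i ∩ A j) ≤ κ) :
    (∑ i ∈ s, #(A i)) ^ 2 ≤ Fintype.card V * (∑ i ∈ s, #(A i) + #s ^ 2 * κ) := by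
  classical
  have hA : ∀ B : Finset V, #B = ∑ v : V, if v ∈ B then 1 else 0 := fun B => by simp
  have h1 : ∑ i ∈ s, #(A i) = ∑ v : V, ∑ i ∈ s, if v ∈ A i then 1 else 0 := by
    rw [Finset.sum_comm]
    exact Finset.sum_congr rfl fun i _ => hA _
  have h2 : ∑ v : V, (∑ i ∈ s, if v ∈ A i then 1 else 0) ^ 2
      = ∑ i ∈ s, ∑ j ∈ s, #(A i ∩ A j) := by
    simp_rw [sq, Finset.sum_mul_sum, hA, Finset.mem_inter, ite_and, ite_mul, one_mul, zero_mul]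
    rw [Finset.sum_comm]
    refine Finset.sum_congr rfl fun i _ => ?_
    rw [Finset.sum_comm]
  have h3 : ∑ i ∈ s, ∑ j ∈ s, #(A i ∩ A j) ≤ ∑ i ∈ s, (#(A i) + #s * κ) := by
    refine Finset.sum_le_sum fun i hi => ?_
    rw [← Finset.add_sum_erase s _ hi, Finset.inter_self]
    gcongr
    calc ∑ j ∈ s.erase i, #(A i ∩ A j) ≤ ∑ j ∈ s.erase i, κ :=
          Finset.sum_le_sum fun j hj =>
            h i hi j (Finset.mem_of_mem_erase hj) (Finset.ne_of_mem_erase hj).symm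
      _ ≤ #s * κ := by
          rw [Finset.sum_const, smul_eq_mul]
          gcongr
          exact Finset.erase_subset _ _
  rw [Finset.sum_add_distrib, Finset.sum_const, smul_eq_mul, ← mul_assoc, ← sq] at h3
  calc (∑ i ∈ s, #(A i)) ^ 2
      ≤ #(Finset.univ : Finset V) * ∑ v : V, (∑ i ∈ s, if v ∈ A i then 1 else 0) ^ 2 := by
        rw [h1]; exact sq_sum_le_card_mul_sum_sq
    _ ≤ _ := by rw [h2, Finset.card_univ]; gcongr

/-- The number of sets of size at least `R` with pairwise intersections of size at most `κ`. -/
theorem card_mul_le_of_card_inter_le (s : Finset ι) (A : ι → Finset V) (κ R : ℕ)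
    (h : ∀ i ∈ s, ∀ j ∈ s, i ≠ j → #(A i ∩ A j) ≤ κ) (hR : ∀ i ∈ s, R ≤ #(A i)) :
    #s * R ≤ 2 * Fintype.card V ∨ R ^ 2 ≤ 2 * Fintype.card V * κ := by
  have h1 := sq_sum_card_le_of_card_inter_le s A κ h
  have h2 : #s * R ≤ ∑ i ∈ s, #(A i) := by
    rw [← smul_eq_mul]
    exact Finset.card_nsmul_le_sum _ _ _ hR
  set S := ∑ i ∈ s, #(A i)
  set n := Fintype.card V
  by_cases hS : S ≤ 2 * n
  · exact Or.inl (h2.trans hS)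
  right
  by_contra! hc
  have hs : 0 < #s := by
    rw [Finset.card_pos, Finset.nonempty_iff_ne_empty]
    rintro he
    apply hS
    simp [S, he]
  have h3 : (#s * R) ^ 2 ≤ S ^ 2 := by gcongr
  have h4 : #s ^ 2 * (2 * n * κ) < #s ^ 2 * R ^ 2 := by gcongr
  have h5 : 2 * n * S ≤ S * S := by gcongr; omega
  nlinarith

/-- A bipartite graph has a subgraph with at least half of the edges whose degrees are at least
a quarter of the average degrees on both sides. -/
theorem exists_regular_subset [DecidableEq ι] (P : Finset ι) (I : Finset (V × ι))
    (hI : ∀ x ∈ I, x.2 ∈ P) :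
    ∃ J ⊆ I, #I ≤ 2 * #J ∧
      (∀ x ∈ J, #I ≤ 4 * Fintype.card V * #{y ∈ J | y.1 = x.1}) ∧
      ∀ x ∈ J, #I ≤ 4 * #P * #{y ∈ J | y.2 = x.2} := by
  rcases I.eq_empty_or_nonempty with rfl | ⟨x₀, hx₀⟩
  · exact ⟨∅, by simp⟩
  have hp : 0 < #P := Finset.card_pos.2 ⟨_, hI _ hx₀⟩
  have hn : 0 < Fintype.card V := Fintype.card_pos_iff.2 ⟨x₀.1⟩
  set n := Fintype.card V
  set p := #P
  obtain ⟨J, hJ, hmax⟩ := Finset.exists_max_image I.powerset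
    (fun J => (4 * n * p * #J : ℤ) - #I * (p * #(J.image Prod.fst) + n * #(J.image Prod.snd)))
    ⟨I, Finset.mem_powerset_self I⟩
  rw [Finset.mem_powerset] at hJ
  have hcard : ∀ (f : V × ι → Prop) [DecidablePred f],
      (#{y ∈ J | f y} : ℤ) + #{y ∈ J | ¬ f y} = #J := fun f _ => by
    exact_mod_cast Finset.card_filter_add_card_filter_not f
  refine ⟨J, hJ, ?_, fun x hx => ?_, fun x hx => ?_⟩
  · have h := hmax I (Finset.mem_powerset_self I)
    have h1 : (#(I.image Prod.fst) : ℤ) ≤ n := by exact_mod_cast Finset.card_le_univ _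
    have h2 : (#(I.image Prod.snd) : ℤ) ≤ p := by
      exact_mod_cast Finset.card_le_card (Finset.image_subset_iff.2 hI)
    have h3 : (p : ℤ) * #(I.image Prod.fst) + n * #(I.image Prod.snd) ≤ 2 * (n * p) := by
      nlinarith
    have h4 : (#I : ℤ) * (p * #(I.image Prod.fst) + n * #(I.image Prod.snd))
        ≤ #I * (2 * (n * p)) := by gcongr
    have h5 : (0 : ℤ) ≤ #I * (p * #(J.image Prod.fst) + n * #(J.image Prod.snd)) := by positivity
    have h6 : (2 * (n * p) : ℤ) * #I ≤ (2 * (n * p)) * (2 * #J) := by linarith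
    exact_mod_cast le_of_mul_le_mul_left h6 (by positivity)
  · have h := hmax {y ∈ J | ¬ y.1 = x.1}
      (Finset.mem_powerset.2 ((Finset.filter_subset _ _).trans hJ))
    have h1 : (#(({y ∈ J | ¬ y.1 = x.1}).image Prod.fst) : ℤ) + 1 ≤ #(J.image Prod.fst) := by
      have : ({y ∈ J | ¬ y.1 = x.1}).image Prod.fst ⊂ J.image Prod.fst := by
        refine (Finset.ssubset_iff_of_subset
          (Finset.image_subset_image (Finset.filter_subset _ _))).2
          ⟨x.1, Finset.mem_image_of_mem _ hx, ?_⟩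
        simp
      exact_mod_cast Finset.card_lt_card this
    have h2 : (#(({y ∈ J | ¬ y.1 = x.1}).image Prod.snd) : ℤ) ≤ #(J.image Prod.snd) := by
      exact_mod_cast Finset.card_le_card (Finset.image_subset_image (Finset.filter_subset _ _))
    have h3 := hcard fun y => y.1 = x.1
    have h4 : (p : ℤ) * #(({y ∈ J | ¬ y.1 = x.1}).image Prod.fst)
        + n * #(({y ∈ J | ¬ y.1 = x.1}).image Prod.snd) + p
        ≤ p * #(J.image Prod.fst) + n * #(J.image Prod.snd) := by nlinarith
    have h5 := mul_le_mul_of_nonneg_left h4 (Int.natCast_nonneg #I)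
    have h6 : (p : ℤ) * #I ≤ p * (4 * n * #{y ∈ J | y.1 = x.1}) := by
      rw [← h3] at h
      linarith
    exact_mod_cast le_of_mul_le_mul_left h6 (by positivity)
  · have h := hmax {y ∈ J | ¬ y.2 = x.2}
      (Finset.mem_powerset.2 ((Finset.filter_subset _ _).trans hJ))
    have h1 : (#(({y ∈ J | ¬ y.2 = x.2}).image Prod.snd) : ℤ) + 1 ≤ #(J.image Prod.snd) := by
      have : ({y ∈ J | ¬ y.2 = x.2}).image Prod.snd ⊂ J.image Prod.snd := by
        refine (Finset.ssubset_iff_of_subset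
          (Finset.image_subset_image (Finset.filter_subset _ _))).2
          ⟨x.2, Finset.mem_image_of_mem _ hx, ?_⟩
        simp
      exact_mod_cast Finset.card_lt_card this
    have h2 : (#(({y ∈ J | ¬ y.2 = x.2}).image Prod.fst) : ℤ) ≤ #(J.image Prod.fst) := by
      exact_mod_cast Finset.card_le_card (Finset.image_subset_image (Finset.filter_subset _ _))
    have h3 := hcard fun y => y.2 = x.2
    have h4 : (p : ℤ) * #(({y ∈ J | ¬ y.2 = x.2}).image Prod.fst)
        + n * #(({y ∈ J | ¬ y.2 = x.2}).image Prod.snd) + n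
        ≤ p * #(J.image Prod.fst) + n * #(J.image Prod.snd) := by nlinarith
    have h5 := mul_le_mul_of_nonneg_left h4 (Int.natCast_nonneg #I)
    have h6 : (n : ℤ) * #I ≤ n * (4 * p * #{y ∈ J | y.2 = x.2}) := by
      rw [← h3] at h
      linarith
    exact_mod_cast le_of_mul_le_mul_left h6 (by positivity)

end Counting

namespace GeodesicSystem

variable {V : Type} {D : GeodesicSystem V}

instance (q : V × V) (x y : V) : Decidable (D.Before q x y) :=
  inferInstanceAs (Decidable (_ = _))

section Rays

variable [DecidableEq V]

variable (D) in
/-- The incidences of the pair of `a` strictly before the vertex of `a`. -/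
def inRay (J : Finset (V × (V × V))) (a : V × (V × V)) : Finset V :=
  {b ∈ J | b.2 = a.2 ∧ b.1 ≠ a.1 ∧ D.Before a.2 b.1 a.1}.image Prod.fst

variable (D) in
/-- The incidences of the pair of `a` strictly after the vertex of `a`. -/
def outRay (J : Finset (V × (V × V))) (a : V × (V × V)) : Finset V :=
  {b ∈ J | b.2 = a.2 ∧ b.1 ≠ a.1 ∧ D.Before a.2 a.1 b.1}.image Prod.fst

variable {J : Finset (V × (V × V))}

theorem mem_inRay {a : V × (V × V)} {y : V} :
    y ∈ D.inRay J a ↔ (y, a.2) ∈ J ∧ y ≠ a.1 ∧ D.Before a.2 y a.1 := by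
  simp only [inRay, Finset.mem_image, Finset.mem_filter]
  constructor
  · rintro ⟨⟨z, q⟩, ⟨hb, rfl, h1, h2⟩, rfl⟩
    exact ⟨hb, h1, h2⟩
  · rintro ⟨h1, h2, h3⟩
    exact ⟨(y, a.2), ⟨h1, rfl, h2, h3⟩, rfl⟩

theorem mem_outRay {a : V × (V × V)} {y : V} :
    y ∈ D.outRay J a ↔ (y, a.2) ∈ J ∧ y ≠ a.1 ∧ D.Before a.2 a.1 y := by
  simp only [outRay, Finset.mem_image, Finset.mem_filter]
  constructor
  · rintro ⟨⟨z, q⟩, ⟨hb, rfl, h1, h2⟩, rfl⟩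
    exact ⟨hb, h1, h2⟩
  · rintro ⟨h1, h2, h3⟩
    exact ⟨(y, a.2), ⟨h1, rfl, h2, h3⟩, rfl⟩

namespace IsIncidence

theorem card_le_rays (hJ : D.IsIncidence J) {a : V × (V × V)} (ha : a ∈ J) :
    #{b ∈ J | b.2 = a.2} ≤ #(D.inRay J a) + #(D.outRay J a) + 1 := by
  have hinj : Set.InjOn Prod.fst
      (({b ∈ J | b.2 = a.2} : Finset (V × (V × V))) : Set (V × (V × V))) := by
    rintro ⟨x, q⟩ hx ⟨y, q'⟩ hy rfl
    simp only [Finset.coe_filter, Set.mem_ofPred_eq] at hx hy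
    rw [hx.2, hy.2]
  rw [← Finset.card_image_of_injOn hinj]
  calc _ ≤ #(insert a.1 (D.inRay J a ∪ D.outRay J a)) := by
        refine Finset.card_le_card ?_
        rintro y hy
        simp only [Finset.mem_image, Finset.mem_filter] at hy
        obtain ⟨⟨z, q⟩, ⟨hb, rfl⟩, rfl⟩ := hy
        simp only [Finset.mem_insert, Finset.mem_union, mem_inRay, mem_outRay]
        by_cases hz : z = a.1
        · exact Or.inl hz
        · rcases (hJ.on hb).before_total (hJ.on ha) with h | h
          · exact Or.inr (Or.inl ⟨hb, hz, h⟩)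
          · exact Or.inr (Or.inr ⟨hb, hz, h⟩)
    _ ≤ _ := (Finset.card_insert_le _ _).trans (by gcongr; exact Finset.card_union_le _ _)

theorem card_mul_le_of_rays [Fintype V] (hJ : D.IsIncidence J) {T : Finset (V × (V × V))}
    (hT : T ⊆ J) {R κ : ℕ} (hR : ∀ a ∈ J, 2 * R + 1 ≤ #{b ∈ J | b.2 = a.2})
    (hin : ∀ a ∈ T, ∀ b ∈ T, a ≠ b → #(D.inRay J a ∩ D.inRay J b) ≤ κ)
    (hout : ∀ a ∈ T, ∀ b ∈ T, a ≠ b → #(D.outRay J a ∩ D.outRay J b) ≤ κ) :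
    #T * R ≤ 4 * Fintype.card V ∨ R ^ 2 ≤ 2 * Fintype.card V * κ := by
  have h1 := card_mul_le_of_card_inter_le {a ∈ T | R ≤ #(D.inRay J a)} (D.inRay J) κ R
    (fun a ha b hb => hin a (Finset.mem_of_mem_filter _ ha) b (Finset.mem_of_mem_filter _ hb))
    (fun a ha => (Finset.mem_filter.1 ha).2)
  have h2 := card_mul_le_of_card_inter_le {a ∈ T | ¬ R ≤ #(D.inRay J a)} (D.outRay J) κ R
    (fun a ha b hb => hout a (Finset.mem_of_mem_filter _ ha) b (Finset.mem_of_mem_filter _ hb))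
    (fun a ha => by
      obtain ⟨ha, h⟩ := Finset.mem_filter.1 ha
      have := hR a (hT ha)
      have := hJ.card_le_rays (hT ha)
      omega)
  have h3 := Finset.card_filter_add_card_filter_not (s := T) fun a => R ≤ #(D.inRay J a)
  rcases h1 with h1 | h1
  · rcases h2 with h2 | h2
    · left
      rw [← h3, add_mul]
      omega
    · exact Or.inr h2
  · exact Or.inr h1

theorem card_fiber_mul_le [Fintype V] (hJ : D.IsIncidence J) {R : ℕ}
    (hR : ∀ a ∈ J, 2 * R + 1 ≤ #{b ∈ J | b.2 = a.2}) (x : V) :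
    #{b ∈ J | b.1 = x} * R ≤ 4 * Fintype.card V := by
  have key := hJ.card_mul_le_of_rays (T := {b ∈ J | b.1 = x}) (Finset.filter_subset _ _)
    (κ := 0) hR ?_ ?_
  · rcases key with key | key
    · exact key
    · have : R = 0 := by simpa using key
      simp [this]
  · rintro ⟨z, q⟩ ha ⟨z', q'⟩ hb hab
    simp only [Finset.mem_filter] at ha hb
    obtain ⟨ha, rfl⟩ := ha
    obtain ⟨hb, rfl⟩ := hb
    have hq : q ≠ q' := fun h => hab (by rw [h])
    rw [Nat.le_zero, Finset.card_eq_zero, Finset.eq_empty_iff_forall_notMem]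
    intro y hy
    rw [Finset.mem_inter, mem_inRay, mem_inRay] at hy
    exact hJ.not_before hq hy.1.2.1 ha hb hy.1.2.2 hy.2.2.2
  · rintro ⟨z, q⟩ ha ⟨z', q'⟩ hb hab
    simp only [Finset.mem_filter] at ha hb
    obtain ⟨ha, rfl⟩ := ha
    obtain ⟨hb, rfl⟩ := hb
    have hq : q ≠ q' := fun h => hab (by rw [h])
    rw [Nat.le_zero, Finset.card_eq_zero, Finset.eq_empty_iff_forall_notMem]
    intro y hy
    rw [Finset.mem_inter, mem_outRay, mem_outRay] at hy
    exact hJ.not_before hq hy.1.2.1.symm hy.1.1 hy.2.1 hy.1.2.2 hy.2.2.2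

end IsIncidence

variable (D) in
/-- Two distinct pairs have `κ` common vertices whose mutual round trips are shorter than `ρ`. -/
def Clustered (J : Finset (V × (V × V))) (κ ρ : ℕ) : Prop :=
  ∃ (q q' : V × V) (X : Finset V), q ≠ q' ∧ #X = κ ∧ (∀ x ∈ X, (x, q) ∈ J ∧ (x, q') ∈ J) ∧
    ∀ x ∈ X, ∀ y ∈ X, D.round x y < ρ

namespace IsIncidence

theorem card_le_of_round_lt (hJ : D.IsIncidence J) {κ ρ : ℕ}
    (hmin : ∀ ρ' < ρ, ¬ D.Clustered J κ ρ') {σ σ' : V × V} (hσ : σ ≠ σ') {Y : Finset V}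
    (hY : ∀ y ∈ Y, (y, σ) ∈ J ∧ (y, σ') ∈ J) (hρ : ∀ x ∈ Y, ∀ y ∈ Y, D.round x y < ρ) :
    #Y ≤ κ := by
  by_contra! hκ
  obtain ⟨m, hm, hmax⟩ := Y.exists_max_image (D.d σ.1) (Finset.card_pos.1 (by omega))
  have hbef : ∀ y ∈ Y, D.Before σ y m := by
    intro y hy
    by_cases hym : m = y
    · subst hym; exact before_refl _ _
    refine ((hJ.on (hY y hy).1).before_total (hJ.on (hY m hm).1)).resolve_right fun h => ?_
    have := D.d_pos hym
    have := hmax y hy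
    simp only [Before] at h
    omega
  obtain ⟨X, hX, hXc⟩ := Finset.exists_subset_card_eq (s := Y.erase m) (n := κ)
    (by rw [Finset.card_erase_of_mem hm]; omega)
  have hρ0 := hρ m hm m hm
  refine hmin (ρ - 1) (by omega) ⟨σ, σ', X, hσ, hXc,
    fun x hx => hY x (Finset.mem_of_mem_erase (hX hx)), fun x hx y hy => ?_⟩
  wlog h : D.Before σ x y generalizing x y
  · rw [round_comm]
    have hx' := hY x (Finset.mem_of_mem_erase (hX hx))
    have hy' := hY y (Finset.mem_of_mem_erase (hX hy))
    exact this y hy x hx (((hJ.on hx'.1).before_total (hJ.on hy'.1)).resolve_left h)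
  have hx' := Finset.mem_of_mem_erase (hX hx)
  have hy' := Finset.mem_of_mem_erase (hX hy)
  have hym := hbef y hy'
  have s1 := hJ.before_swap hσ (hY x hx').2 (hY y hy').1 (hY y hy').2 h
  have s2 := hJ.before_swap hσ (hY y hy').2 (hY m hm).1 (hY m hm).2 hym
  have e1 := h.trans_d hym
  have e2 := s2.trans_d s1
  have e3 := hρ x hx' m hm
  have e4 := D.d_pos (Finset.ne_of_mem_erase (hX hy))
  simp only [round] at e3 ⊢
  omega

theorem card_cluster_mul_le [Fintype V] (hJ : D.IsIncidence J) {R κ k : ℕ}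
    (hR : ∀ a ∈ J, 2 * R + 1 ≤ #{b ∈ J | b.2 = a.2})
    (hk : ∀ a ∈ J, k + 2 ≤ #{b ∈ J | b.1 = a.1}) {q q' : V × V} (hq : q ≠ q')
    {X : Finset V} (hXc : #X = κ) (hX : ∀ x ∈ X, (x, q) ∈ J ∧ (x, q') ∈ J) :
    κ * k * R ≤ 4 * Fintype.card V ∨ R ^ 2 ≤ 2 * Fintype.card V * κ := by
  classical
  have hex : ∃ ρ, D.Clustered J κ ρ :=
    ⟨X.sup (fun x => X.sup fun y => D.round x y) + 1, q, q', X, hq, hXc, hX, fun x hx y hy =>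
      Nat.lt_succ_of_le ((Finset.le_sup (f := fun y => D.round x y) hy).trans
        (Finset.le_sup (f := fun x => X.sup fun y => D.round x y) hx))⟩
  clear hX hXc hq
  clear X q q'
  obtain ⟨ρ, ⟨q, q', X, hq, hXc, hX, hρ⟩, hmin⟩ :
      ∃ ρ, D.Clustered J κ ρ ∧ ∀ ρ' < ρ, ¬ D.Clustered J κ ρ' :=
    ⟨Nat.find hex, Nat.find_spec hex, fun _ => Nat.find_min hex⟩
  set T : Finset (V × (V × V)) := {b ∈ J | b.1 ∈ X ∧ b.2 ≠ q ∧ b.2 ≠ q'} with hT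
  have hne : ∀ a ∈ T, ∀ b ∈ T, a ≠ b → a.2 ≠ b.2 := by
    rintro ⟨x, σ⟩ ha ⟨y, σ'⟩ hb hab h
    obtain rfl : σ = σ' := h
    simp only [hT, Finset.mem_filter] at ha hb
    refine hab ?_
    rw [hJ.eq_of_three hq ha.2.2.1.symm ha.2.2.2.symm (hX x ha.2.1).1 (hX x ha.2.1).2 ha.1
      (hX y hb.2.1).1 (hX y hb.2.1).2 hb.1]
  have hcard : κ * k ≤ #T := by
    rw [← hXc, ← smul_eq_mul, Finset.card_eq_sum_card_fiberwise (f := Prod.fst) (t := X)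
      (fun a ha => (Finset.mem_filter.1 ha).2.1)]
    refine Finset.card_nsmul_le_sum _ _ _ fun x hx => ?_
    have h1 := hk _ (hX x hx).1
    have h2 : ({b ∈ J | b.1 = x} : Finset _) ⊆
        insert (x, q) (insert (x, q') {b ∈ T | b.1 = x}) := by
      rintro ⟨y, σ⟩ hb
      obtain ⟨hb, h⟩ := Finset.mem_filter.1 hb
      obtain rfl : y = x := h
      simp only [hT, Finset.mem_insert, Finset.mem_filter, Prod.mk.injEq, true_and]
      tauto
    have h3 := (Finset.card_le_card h2).trans ((Finset.card_insert_le _ _).trans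
      (Nat.succ_le_succ (Finset.card_insert_le _ _)))
    simp only at h1
    omega
  have key := hJ.card_mul_le_of_rays (T := T) (Finset.filter_subset _ _) (κ := κ) hR ?_ ?_
  · refine key.imp_left fun h => (Nat.mul_le_mul_right R hcard).trans h
  · intro a ha b hb hab
    refine hJ.card_le_of_round_lt hmin (hne a ha b hb hab) (fun y hy => ?_) fun y hy z hz => ?_
    · rw [Finset.mem_inter, mem_inRay, mem_inRay] at hy
      exact ⟨hy.1.1, hy.2.1⟩
    · rw [Finset.mem_inter, mem_inRay, mem_inRay] at hy hz
      exact (hJ.round_le_of_before (hne a ha b hb hab) hy.1.1 hz.1.1 hy.2.1 hz.2.1 hy.1.2.2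
        hz.1.2.2 hy.2.2.2 hz.2.2.2).trans_lt
        (hρ _ (Finset.mem_filter.1 ha).2.1 _ (Finset.mem_filter.1 hb).2.1)
  · intro a ha b hb hab
    refine hJ.card_le_of_round_lt hmin (hne a ha b hb hab) (fun y hy => ?_) fun y hy z hz => ?_
    · rw [Finset.mem_inter, mem_outRay, mem_outRay] at hy
      exact ⟨hy.1.1, hy.2.1⟩
    · rw [Finset.mem_inter, mem_outRay, mem_outRay] at hy hz
      exact (hJ.round_le_of_after (hne a ha b hb hab) hy.1.1 hz.1.1 hy.2.1 hz.2.1 hy.1.2.2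
        hz.1.2.2 hy.2.2.2 hz.2.2.2).trans_lt
        (hρ _ (Finset.mem_filter.1 ha).2.1 _ (Finset.mem_filter.1 hb).2.1)

end IsIncidence

end Rays

end GeodesicSystem

namespace GeodesicSystem.IsIncidence

variable {V : Type} [Fintype V] [DecidableEq V] {D : GeodesicSystem V}
  {I : Finset (V × (V × V))} {P : Finset (V × V)}

theorem sq_card_le (hI : D.IsIncidence I) (hP : ∀ x ∈ I, x.2 ∈ P) (hp : 0 < #P)
    (hE : 16 * #P ≤ #I) : #I ^ 2 ≤ 512 * Fintype.card V ^ 2 * #P := by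
  obtain ⟨J, hJI, hcard, hV, hQ⟩ := exists_regular_subset P I hP
  have hJ := hI.mono hJI
  obtain ⟨x, hx⟩ : J.Nonempty := Finset.card_pos.1 (by omega)
  set n := Fintype.card V
  set p := #P
  set E := #I
  set R := E / (16 * p)
  have hR1 : 1 ≤ R := (Nat.one_le_div_iff (by omega)).2 hE
  have hRE : 16 * p * R ≤ E := Nat.mul_div_le _ _
  have hER : E ≤ 32 * p * R := by
    have : E < 16 * p * (R + 1) := Nat.lt_mul_div_succ _ (by omega)
    nlinarith
  have hdeg : ∀ a ∈ J, 2 * R + 1 ≤ #{b ∈ J | b.2 = a.2} := fun a ha => by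
    have h1 : 4 * p * (4 * R) ≤ 4 * p * #{b ∈ J | b.2 = a.2} := by linarith [hQ a ha]
    have := Nat.le_of_mul_le_mul_left h1 (by omega)
    omega
  have h1 := hJ.card_fiber_mul_le hdeg x.1
  have h2 := hV x hx
  set m := #{b ∈ J | b.1 = x.1}
  calc E ^ 2 = E * E := sq _
    _ ≤ (4 * n * m) * (32 * p * R) := Nat.mul_le_mul h2 hER
    _ = 128 * n * p * (m * R) := by ring
    _ ≤ 128 * n * p * (4 * n) := by gcongr
    _ = _ := by ring

theorem sq_card_le_or (hI : D.IsIncidence I) (hP : ∀ x ∈ I, x.2 ∈ P) (hp : 0 < #P)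
    (hE : 16 * #P ≤ #I) (hn : 16 * Fintype.card V ≤ #I) :
    #I ^ 2 ≤ 4096 * Fintype.card V * #P ^ 2 ∨
      #I ^ 4 ≤ 2 ^ 24 * Fintype.card V ^ 3 * #P ^ 3 := by
  obtain ⟨J, hJI, hcard, hV, hQ⟩ := exists_regular_subset P I hP
  have hJ := hI.mono hJI
  obtain ⟨x, hx⟩ : J.Nonempty := Finset.card_pos.1 (by omega)
  have hn0 : 0 < Fintype.card V := Fintype.card_pos_iff.2 ⟨x.1⟩
  set n := Fintype.card V
  set p := #P
  set E := #I
  rw [or_iff_not_imp_left]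
  intro hEnp
  set R := E / (16 * p)
  have hR1 : 1 ≤ R := (Nat.one_le_div_iff (by omega)).2 hE
  have hRE : 16 * p * R ≤ E := Nat.mul_div_le _ _
  have hER : E ≤ 32 * p * R := by
    have : E < 16 * p * (R + 1) := Nat.lt_mul_div_succ _ (by omega)
    nlinarith
  have hdeg : ∀ a ∈ J, 2 * R + 1 ≤ #{b ∈ J | b.2 = a.2} := fun a ha => by
    have h1 : 4 * p * (4 * R) ≤ 4 * p * #{b ∈ J | b.2 = a.2} := by linarith [hQ a ha]
    have := Nat.le_of_mul_le_mul_left h1 (by omega)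
    omega
  set k := E / (8 * n)
  have hk2 : 2 ≤ k := (Nat.le_div_iff_mul_le (by omega)).2 (by omega)
  have hkE : 8 * n * k ≤ E := Nat.mul_div_le _ _
  have hEk : E ≤ 16 * n * k := by
    have : E < 8 * n * (k + 1) := Nat.lt_mul_div_succ _ (by omega)
    nlinarith
  have hdeg' : ∀ a ∈ J, k + 2 ≤ #{b ∈ J | b.1 = a.1} := fun a ha => by
    have h1 : 4 * n * (2 * k) ≤ 4 * n * #{b ∈ J | b.1 = a.1} := by linarith [hV a ha]
    have := Nat.le_of_mul_le_mul_left h1 (by omega)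
    omega
  have hc : 0 < 4096 * n * p ^ 2 := by positivity
  set κ := E ^ 2 / (4096 * n * p ^ 2)
  have hκ1 : 1 ≤ κ := (Nat.one_le_div_iff hc).2 (by omega)
  have hκE : 4096 * n * p ^ 2 * κ ≤ E ^ 2 := Nat.mul_div_le _ _
  have hEκ : E ^ 2 ≤ 8192 * n * p ^ 2 * κ := by
    have : E ^ 2 < 4096 * n * p ^ 2 * (κ + 1) := Nat.lt_mul_div_succ _ hc
    nlinarith
  have hpos : 0 < n * p ^ 2 * κ := by positivity
  obtain ⟨q, q', hq, X, hXc, hX⟩ : ∃ q q' : V × V, q ≠ q' ∧ ∃ X : Finset V, #X = κ ∧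
      ∀ x ∈ X, (x, q) ∈ J ∧ (x, q') ∈ J := by
    by_contra! hno
    set A : V × V → Finset V := fun q => {x | (x, q) ∈ J} with hA
    have h1 := sq_sum_card_le_of_card_inter_le P A κ fun q _ q' _ hq => by
      by_contra! hlt
      obtain ⟨X, hX, hXc⟩ := Finset.exists_subset_card_eq hlt.le
      obtain ⟨x, hx, h⟩ := hno q q' hq X hXc
      have := hX hx
      simp only [hA, Finset.mem_inter, Finset.mem_filter_univ] at this
      exact h this.1 this.2
    have h2 : ∑ q ∈ P, #(A q) = #J := by
      rw [Finset.card_eq_sum_card_fiberwise (f := Prod.snd) (t := P) fun a ha => hP a (hJI ha)]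
      refine Finset.sum_congr rfl fun q _ => ?_
      refine Finset.card_bij (fun x _ => (x, q)) ?_ ?_ ?_
      · simp [hA]
      · simp
      · rintro ⟨x, q'⟩ h
        simp only [Finset.mem_filter] at h
        obtain ⟨h, rfl⟩ := h
        exact ⟨x, by simpa [hA] using h, rfl⟩
    rw [h2] at h1
    have h3 : 8 * n ≤ #J := by omega
    have h4 : 8 * n * #J ≤ #J * #J := by gcongr
    have h5 : E ^ 2 ≤ (2 * #J) ^ 2 := by gcongr
    nlinarith
  have key := hJ.card_cluster_mul_le hdeg hdeg' hq hXc hX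
  rcases key with key | key
  · calc E ^ 4 = E ^ 2 * (E * E) := by ring
      _ ≤ (8192 * n * p ^ 2 * κ) * ((16 * n * k) * (32 * p * R)) := by gcongr
      _ = 2 ^ 22 * n ^ 2 * p ^ 3 * (κ * k * R) := by ring
      _ ≤ 2 ^ 22 * n ^ 2 * p ^ 3 * (4 * n) := by gcongr
      _ = _ := by ring
  · exfalso
    have h1 : E ^ 2 ≤ (32 * p * R) ^ 2 := by gcongr
    have h2 : p ^ 2 * R ^ 2 ≤ p ^ 2 * (2 * n * κ) := by gcongr
    nlinarith

theorem card_le (hI : D.IsIncidence I) (hP : ∀ x ∈ I, x.2 ∈ P) :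
    #I ≤ 16 * Fintype.card V ∨ #I ^ 6 ≤ 64 ^ 6 * (Fintype.card V ^ 5 * #P ^ 4) := by
  have hpn : #P ≤ Fintype.card V ^ 2 := by
    simpa [sq] using Finset.card_le_univ P
  rcases P.eq_empty_or_nonempty with rfl | hne
  · left
    have : I = ∅ := Finset.eq_empty_of_forall_notMem fun x hx => by simpa using hP x hx
    simp [this]
  have hp := hne.card_pos
  have h1 := hI.sq_card_le hP hp
  have h2 := hI.sq_card_le_or hP hp
  have hn : 0 < Fintype.card V := by
    by_contra! h
    simp only [Nat.le_zero] at h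
    simp [h] at hpn
    simp [hpn] at hne
  set n := Fintype.card V
  set p := #P
  set E := #I
  rw [or_iff_not_imp_left, not_le]
  intro hEn
  rcases le_or_gt (16 * p) E with hE | hE
  · rcases le_or_gt n p with hnp | hnp
    · calc E ^ 6 = (E ^ 2) ^ 3 := by ring
        _ ≤ (512 * n ^ 2 * p) ^ 3 := by gcongr; exact h1 hE
        _ = 512 ^ 3 * (n ^ 5 * p ^ 3 * n) := by ring
        _ ≤ 64 ^ 6 * (n ^ 5 * p ^ 3 * p) := by gcongr ?_ * (_ * ?_); norm_num
        _ = _ := by ring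
    · rcases h2 hE hEn.le with h | h
      · calc E ^ 6 = (E ^ 2) ^ 3 := by ring
          _ ≤ (4096 * n * p ^ 2) ^ 3 := by gcongr
          _ = 64 ^ 6 * (n ^ 3 * p ^ 4 * p ^ 2) := by ring
          _ ≤ 64 ^ 6 * (n ^ 3 * p ^ 4 * n ^ 2) := by gcongr
          _ = _ := by ring
      · refine (Nat.pow_le_pow_iff_left (n := 2) (by norm_num)).1 ?_
        calc (E ^ 6) ^ 2 = (E ^ 4) ^ 3 := by ring
          _ ≤ (2 ^ 24 * n ^ 3 * p ^ 3) ^ 3 := by gcongr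
          _ = 64 ^ 12 * (n ^ 9 * p ^ 8 * p) := by ring
          _ ≤ 64 ^ 12 * (n ^ 9 * p ^ 8 * n) := by gcongr
          _ = _ := by ring
  · calc E ^ 6 ≤ (16 * p) ^ 6 := by gcongr
      _ = 16 ^ 6 * (p ^ 2 * p ^ 4) := by ring
      _ ≤ 64 ^ 6 * ((n ^ 2) ^ 2 * p ^ 4) := by gcongr; norm_num
      _ = 64 ^ 6 * (n ^ 4 * p ^ 4) := by ring
      _ ≤ 64 ^ 6 * (n ^ 5 * p ^ 4) := by gcongr; omega

theorem card_le_real (hI : D.IsIncidence I) (hP : ∀ x ∈ I, x.2 ∈ P) :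
    (#I : ℝ) ≤ 64 * ((Fintype.card V : ℝ) ^ ((5 : ℝ) / 6) * (#P : ℝ) ^ ((2 : ℝ) / 3)
      + Fintype.card V) := by
  have h0 : (0 : ℝ) ≤ (Fintype.card V : ℝ) ^ ((5 : ℝ) / 6) * (#P : ℝ) ^ ((2 : ℝ) / 3) := by
    positivity
  have hn : (0 : ℝ) ≤ Fintype.card V := by positivity
  rcases hI.card_le hP with h | h
  · have : (#I : ℝ) ≤ 16 * Fintype.card V := by exact_mod_cast h
    linarith
  · have h' : (#I : ℝ) ^ 6 ≤
        (64 * ((Fintype.card V : ℝ) ^ ((5 : ℝ) / 6) * (#P : ℝ) ^ ((2 : ℝ) / 3))) ^ 6 := by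
      rw [mul_pow, mul_pow, ← Real.rpow_mul_natCast (by positivity),
        ← Real.rpow_mul_natCast (by positivity)]
      norm_num
      exact_mod_cast h
    have := le_of_pow_le_pow_left₀ (by norm_num) (by positivity) h'
    linarith

end GeodesicSystem.IsIncidence

section WeightedDistance

variable {V : Type} {W : V × V → ℕ}

/-- `Traversal W x y c` means that some walk from `x` to `y` has total weight `c`. -/
inductive Traversal (W : V × V → ℕ) (x : V) : V → ℕ → Prop
  | nil : Traversal W x x 0
  | snoc {u c} (y : V) : Traversal W x u c → Traversal W x y (c + W (u, y))

theorem Traversal.trans {x y z : V} {c c' : ℕ} (h : Traversal W x y c)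
    (h' : Traversal W y z c') : Traversal W x z (c + c') := by
  induction h' with
  | nil => exact h
  | snoc z _ ih => rw [← add_assoc]; exact ih.snoc z

theorem Traversal.single (x y : V) : Traversal W x y (W (x, y)) := by
  simpa using Traversal.nil.snoc (W := W) (x := x) y

/-- The distance in the complete digraph with edge weights `W`. -/
noncomputable def weightedDist (W : V × V → ℕ) (x y : V) : ℕ := sInf {c | Traversal W x y c}

theorem traversal_weightedDist (x y : V) : Traversal W x y (weightedDist W x y) :=
  Nat.sInf_mem (s := {c | Traversal W x y c}) ⟨_, Traversal.single x y⟩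

theorem Traversal.weightedDist_le {x y : V} {c : ℕ} (h : Traversal W x y c) :
    weightedDist W x y ≤ c :=
  Nat.sInf_le h

theorem weightedDist_self (x : V) : weightedDist W x x = 0 :=
  Nat.le_zero.1 Traversal.nil.weightedDist_le

theorem weightedDist_triangle (x y z : V) :
    weightedDist W x z ≤ weightedDist W x y + weightedDist W y z :=
  ((traversal_weightedDist x y).trans (traversal_weightedDist y z)).weightedDist_le

theorem weightedDist_le (x y : V) : weightedDist W x y ≤ W (x, y) :=
  (Traversal.single x y).weightedDist_le

theorem weightedDist_pos (hW : ∀ e, 0 < W e) {x y : V} (h : x ≠ y) : 0 < weightedDist W x y := by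
  have := traversal_weightedDist (W := W) x y
  generalize weightedDist W x y = c at this
  cases this with
  | nil => exact absurd rfl h
  | snoc _ _ => exact Nat.add_pos_right _ (hW _)

variable (W) in
/-- The edge `(u, y)` ends some shortest path from `x` to `y`. -/
def IsTight (x y u : V) : Prop := weightedDist W x u + W (u, y) = weightedDist W x y

theorem exists_isTight {x y : V} (h : x ≠ y) : ∃ u, IsTight W x y u := by
  have key : ∀ c, Traversal W x y c → ∃ u, weightedDist W x u + W (u, y) ≤ c := by
    rintro c (_ | ⟨_, hc⟩)
    · exact absurd rfl h
    · exact ⟨_, Nat.add_le_add_right hc.weightedDist_le _⟩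
  obtain ⟨u, hu⟩ := key _ (traversal_weightedDist x y)
  exact ⟨u, hu.antisymm ((traversal_weightedDist x u).snoc y).weightedDist_le⟩

theorem exists_sum_eq_weightedDist (hW : ∀ e, 0 < W e) (x y : V) :
    ∃ S : Finset (V × V), ∑ e ∈ S, W e = weightedDist W x y ∧
      ∀ e ∈ S, weightedDist W x e.2 ≤ weightedDist W x y := by
  classical
  induction hN : weightedDist W x y using Nat.strong_induction_on generalizing y with
  | _ N ih =>
    subst hN
    rcases eq_or_ne x y with rfl | hxy
    · exact ⟨∅, by simp [weightedDist_self]⟩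
    · obtain ⟨u, hu⟩ := exists_isTight (W := W) hxy
      have hlt : weightedDist W x u < weightedDist W x y := by
        rw [← hu]; exact Nat.lt_add_of_pos_right (hW _)
      obtain ⟨S, hS, hSle⟩ := ih _ hlt u rfl
      have hmem : (u, y) ∉ S := fun h => (hSle _ h).not_gt hlt
      refine ⟨insert (u, y) S, ?_, ?_⟩
      · rw [Finset.sum_insert hmem, hS, add_comm]; exact hu
      · simp only [Finset.mem_insert, forall_eq_or_imp, le_refl, true_and]
        exact fun e he => (hSle e he).trans hlt.le

theorem IsTight.unique (hW : ∀ e, 0 < W e)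
    (hinj : Function.Injective fun S : Finset (V × V) => ∑ e ∈ S, W e) {x y u v : V}
    (hu : IsTight W x y u) (hv : IsTight W x y v) : u = v := by
  classical
  have key : ∀ {u}, IsTight W x y u → ∃ S : Finset (V × V), (u, y) ∈ S ∧
      ∑ e ∈ S, W e = weightedDist W x y ∧ ∀ v, (v, y) ∈ S → v = u := by
    intro u hu
    obtain ⟨S, hS, hSle⟩ := exists_sum_eq_weightedDist hW x u
    have hlt : weightedDist W x u < weightedDist W x y := by
      rw [← hu]; exact Nat.lt_add_of_pos_right (hW _)
    have hmem : ∀ v, (v, y) ∉ S := fun v h => (hSle _ h).not_gt hlt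
    refine ⟨insert (u, y) S, Finset.mem_insert_self _ _, ?_, fun v hv => ?_⟩
    · rw [Finset.sum_insert (hmem u), hS, add_comm]; exact hu
    · simpa [hmem v] using hv
  obtain ⟨S, hS, hSsum, -⟩ := key hu
  obtain ⟨T, -, hTsum, hT⟩ := key hv
  obtain rfl : S = T := hinj (hSsum.trans hTsum.symm)
  exact hT u hS

open Classical in
/-- The geodesics of positive weights all of whose subset sums are distinct. -/
noncomputable def GeodesicSystem.ofWeights (W : V × V → ℕ) (hW : ∀ e, 0 < W e)
    (hinj : Function.Injective fun S : Finset (V × V) => ∑ e ∈ S, W e) : GeodesicSystem V :=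
  have spec : ∀ {x y : V} (h : x ≠ y), IsTight W x y
      (if h : x ≠ y then (exists_isTight (W := W) h).choose else x) := fun {x y} h => by
    rw [dif_pos h]; exact (exists_isTight h).choose_spec
  { d := weightedDist W
    pred := fun x y => if h : x ≠ y then (exists_isTight (W := W) h).choose else x
    d_self := weightedDist_self
    d_pos := weightedDist_pos hW
    triangle := weightedDist_triangle
    pred_ne := fun {x y} h hu => by
      have h1 := spec h
      rw [hu, IsTight] at h1
      have := hW (y, y)
      omega
    pred_between := fun {x y} h => by
      have h1 := spec h
      set u := if h : x ≠ y then (exists_isTight (W := W) h).choose else x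
      rw [IsTight] at h1
      have h2 := weightedDist_le (W := W) u y
      have h3 := weightedDist_triangle (W := W) x u y
      omega
    pred_eq := fun {s x y} hs hxy => by
      have hsy : s ≠ y := by
        rintro rfl
        have h1 := weightedDist_self (W := W) s
        have h2 := weightedDist_pos hW hxy
        omega
      refine (spec hsy).unique hW hinj ?_
      have h1 := spec hxy
      set u := if h : x ≠ y then (exists_isTight (W := W) h).choose else x
      rw [IsTight] at h1 ⊢
      have h2 := weightedDist_le (W := W) u y
      have h3 := weightedDist_triangle (W := W) s u y
      have h4 := weightedDist_triangle (W := W) s x u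
      omega }

theorem GeodesicSystem.ofWeights_pred (hW : ∀ e, 0 < W e)
    (hinj : Function.Injective fun S : Finset (V × V) => ∑ e ∈ S, W e) {x y : V} (h : x ≠ y) :
    IsTight W x y ((GeodesicSystem.ofWeights W hW hinj).pred x y) := by
  simp only [GeodesicSystem.ofWeights]
  rw [dif_pos h]
  exact (exists_isTight h).choose_spec

end WeightedDistance

section Perturbation

/-- The position of an element in an enumeration of a finite type. -/
noncomputable def indexEmbedding (α : Type*) [Fintype α] : α ↪ ℕ :=
  (Fintype.equivFin α).toEmbedding.trans Fin.valEmbedding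

/-- The weights `c`, scaled and perturbed so that distinct sets have distinct weights. -/
noncomputable def perturb {α : Type*} [Fintype α] (c : α → ℕ) (e : α) : ℕ :=
  2 ^ Fintype.card α * c e + 2 ^ indexEmbedding α e

variable {α : Type*} [Fintype α] (c : α → ℕ)

theorem indexEmbedding_lt (e : α) : indexEmbedding α e < Fintype.card α :=
  (Fintype.equivFin α e).2

theorem perturb_pos (e : α) : 0 < perturb c e := by
  unfold perturb; positivity

theorem le_perturb (e : α) : 2 ^ Fintype.card α * c e ≤ perturb c e := Nat.le_add_right _ _

theorem perturb_le (e : α) : perturb c e ≤ 2 ^ Fintype.card α * (c e + 1) := by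
  rw [perturb, mul_add, mul_one]
  exact Nat.add_le_add_left
    (Nat.pow_le_pow_right (by norm_num) (indexEmbedding_lt e).le) _

theorem sum_perturb_injective : Function.Injective fun S : Finset α => ∑ e ∈ S, perturb c e := by
  have hlt : ∀ S : Finset α, ∑ e ∈ S, 2 ^ indexEmbedding α e < 2 ^ Fintype.card α := by
    intro S
    rw [← Finset.sum_map S (indexEmbedding α) (fun i => 2 ^ i)]
    refine Nat.geomSum_lt le_rfl fun k hk => ?_
    obtain ⟨e, -, rfl⟩ := Finset.mem_map.1 hk
    exact indexEmbedding_lt e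
  have hmod : ∀ S : Finset α, (∑ e ∈ S, perturb c e) % 2 ^ Fintype.card α
      = ∑ i ∈ S.map (indexEmbedding α), 2 ^ i := by
    intro S
    simp only [perturb]
    rw [Finset.sum_add_distrib, ← Finset.mul_sum, Nat.mul_add_mod, Nat.mod_eq_of_lt (hlt S),
      Finset.sum_map]
  intro S T h
  refine Finset.map_injective (indexEmbedding α) (Finset.geomSum_injective le_rfl ?_)
  simp only at h ⊢
  rw [← hmod, ← hmod, h]

end Perturbation

section Digraph

variable {V : Type} {E F : Finset (V × V)}

theorem IsWalkOn.mono (h : E ⊆ F) {s t : V} {l : List V} (hl : IsWalkOn E s t l) :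
    IsWalkOn F s t l :=
  ⟨hl.1.imp fun _ _ m => h m, hl.2⟩

theorem IsWalkOn.ne_nil {s t : V} {l : List V} (hl : IsWalkOn E s t l) : l ≠ [] := by
  rintro rfl
  simpa using hl.2.1

theorem isWalkOn_singleton (s : V) : IsWalkOn E s s [s] :=
  ⟨List.isChain_singleton s, rfl, rfl⟩

theorem IsWalkOn.snoc {s t u : V} {l : List V} (hl : IsWalkOn E s t l) (h : (t, u) ∈ E) :
    IsWalkOn E s u (l ++ [u]) := by
  refine ⟨List.isChain_append.2 ⟨hl.1, List.isChain_singleton u, ?_⟩, ?_, ?_⟩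
  · simp [hl.2.2, h]
  · simp [hl.2.1]
  · simp

theorem IsWalkOn.exists_traversal {W : V × V → ℕ} {M : ℕ} (hM : ∀ e ∈ E, W e ≤ M) {s t : V}
    {l : List V} (hl : IsWalkOn E s t l) : ∃ c, Traversal W s t c ∧ c ≤ (l.length - 1) * M := by
  induction l generalizing s with
  | nil => exact absurd rfl hl.ne_nil
  | cons a l ih =>
    obtain ⟨h1, h2, h3⟩ := hl
    obtain rfl : a = s := by simpa using h2
    cases l with
    | nil =>
      obtain rfl : a = t := by simpa using h3
      exact ⟨0, .nil, by simp⟩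
    | cons b l =>
      obtain ⟨hab, h1⟩ := List.isChain_cons_cons.1 h1
      obtain ⟨c, hc, hcl⟩ := ih (s := b) ⟨h1, rfl, by simpa using h3⟩
      refine ⟨_, (Traversal.single a b).trans hc, ?_⟩
      have := hM _ hab
      simp only [List.length_cons, Nat.add_sub_cancel] at hcl ⊢
      rw [Nat.add_mul, one_mul, add_comm]
      exact Nat.add_le_add hcl this

namespace WDigraph

variable {G : WDigraph V}

theorem Unweighted.walkWeight (hG : G.Unweighted) {s t : V} {l : List V}
    (hl : IsWalkOn G.Edge s t l) : G.walkWeight l = ((l.length - 1 : ℕ) : ℝ) := by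
  induction l generalizing s with
  | nil => exact absurd rfl hl.ne_nil
  | cons a l ih =>
    obtain ⟨h1, -, h3⟩ := hl
    cases l with
    | nil => simp [WDigraph.walkWeight]
    | cons b l =>
      obtain ⟨hab, h1⟩ := List.isChain_cons_cons.1 h1
      have := ih (s := b) ⟨h1, rfl, by simpa using h3⟩
      simp only [WDigraph.walkWeight, List.tail_cons, List.zip_cons_cons, List.map_cons,
        List.sum_cons, hG _ hab, List.length_cons, Nat.add_sub_cancel] at this ⊢
      rw [this]
      push_cast
      ring

theorem Unweighted.distOn_eq (hG : G.Unweighted) (hF : F ⊆ G.Edge) {s t : V} {l : List V}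
    (hl : IsWalkOn F s t l) (hmin : ∀ l', IsWalkOn G.Edge s t l' → l.length ≤ l'.length) :
    G.distOn F s t = G.dist s t := by
  have key : ∀ E ⊆ G.Edge, IsWalkOn E s t l → G.distOn E s t = ((l.length - 1 : ℕ) : ℝ) := by
    intro E hE hl
    refine IsLeast.csInf_eq ⟨⟨l, hl, hG.walkWeight (hl.mono hE)⟩, ?_⟩
    rintro _ ⟨l', hl', rfl⟩
    rw [hG.walkWeight (hl'.mono hE)]
    exact_mod_cast Nat.sub_le_sub_right (hmin l' (hl'.mono hE)) 1
  rw [WDigraph.dist, key F hF hl, key _ subset_rfl (hl.mono hF)]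

end WDigraph

/-- Tie breaking: every finite digraph has a system of unique shortest paths, closed under
subpaths, each of which has the smallest number of edges. -/
theorem exists_geodesicSystem [Fintype V] (E : Finset (V × V)) :
    ∃ D : GeodesicSystem V, ∀ s t, ReachableOn E s t →
      (∀ y, D.On (s, t) y → y ≠ s → (D.pred s y, y) ∈ E) ∧
      ∀ F : Finset (V × V), (∀ y, D.On (s, t) y → y ≠ s → (D.pred s y, y) ∈ F) →
        ∃ l, IsWalkOn F s t l ∧ ∀ l', IsWalkOn E s t l' → l.length ≤ l'.length := by
  classical
  let hop : V → V → ℕ := fun x y => sInf {h | ∃ l, IsWalkOn E x y l ∧ l.length = h + 1}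
  set K := 1 + ∑ x, ∑ y, hop x y with hK
  have hhop : ∀ x y, hop x y < K := by
    intro x y
    rw [hK, add_comm, Nat.lt_succ_iff]
    exact (Finset.single_le_sum (f := fun y => hop x y) (fun _ _ => Nat.zero_le _)
      (Finset.mem_univ y)).trans
      (Finset.single_le_sum (f := fun x => ∑ y, hop x y) (fun _ _ => Nat.zero_le _)
      (Finset.mem_univ x))
  set N := 2 ^ Fintype.card (V × V) with hN
  have hN0 : 0 < N := by positivity
  set c : V × V → ℕ := fun e => if e ∈ E then K else K ^ 2 with hc
  have hinj := sum_perturb_injective c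
  set D := GeodesicSystem.ofWeights (perturb c) (perturb_pos c) hinj
  have hKK : K ≤ K ^ 2 := Nat.le_self_pow (by norm_num) K
  have hlow : ∀ e, N * K ≤ perturb c e := fun e => by
    refine le_trans ?_ (le_perturb c e)
    gcongr
    simp only [hc]
    split_ifs <;> omega
  have htight : ∀ {x y : V}, x ≠ y → D.d x (D.pred x y) + perturb c (D.pred x y, y) = D.d x y :=
    fun h => GeodesicSystem.ofWeights_pred (perturb_pos c) hinj h
  refine ⟨D, fun s t hst => ?_⟩
  obtain ⟨l₀, hl₀, hlen⟩ : hop s t ∈ {h | ∃ l, IsWalkOn E s t l ∧ l.length = h + 1} := by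
    refine Nat.sInf_mem ?_
    obtain ⟨l, hl⟩ := hst
    have := List.length_pos_iff.2 hl.ne_nil
    exact ⟨l.length - 1, l, hl, by omega⟩
  have hmin : ∀ l', IsWalkOn E s t l' → hop s t + 1 ≤ l'.length := by
    intro l' hl'
    have := List.length_pos_iff.2 hl'.ne_nil
    have : hop s t ≤ l'.length - 1 := Nat.sInf_le ⟨l', hl', by omega⟩
    omega
  have hdle : D.d s t ≤ hop s t * (N * (K + 1)) := by
    obtain ⟨w, hw, hwle⟩ := hl₀.exists_traversal (W := perturb c) (M := N * (K + 1))
      fun e he => by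
        have := perturb_le c e
        simpa only [hc, if_pos he] using this
    rw [hlen, Nat.add_sub_cancel] at hwle
    exact hw.weightedDist_le.trans hwle
  have hd1 : D.d s t < (hop s t + 1) * (N * K) := by
    have := hhop s t
    nlinarith
  have hd2 : D.d s t < N * K ^ 2 := by
    have := hhop s t
    nlinarith
  refine ⟨fun y hy hys => ?_, fun F hF => ?_⟩
  · by_contra hE
    have h1 := htight hys.symm
    have h2 := le_perturb c (D.pred s y, y)
    simp only [GeodesicSystem.On] at hy
    rw [hc] at h2
    simp only [if_neg hE] at h2
    rw [← hN, ← hc] at h2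
    omega
  · have key : ∀ y, D.On (s, t) y → ∃ l, IsWalkOn F s y l ∧ (l.length - 1) * (N * K) ≤ D.d s y := by
      intro y hy
      induction hM : D.d s y using Nat.strong_induction_on generalizing y with
      | _ M ih =>
        subst hM
        rcases eq_or_ne s y with rfl | hsy
        · exact ⟨[s], isWalkOn_singleton s, by simp⟩
        have h1 := htight hsy
        have h2 := hlow (D.pred s y, y)
        have h3 := D.pred_between hsy
        have h4 := D.triangle s (D.pred s y) t
        have h5 := D.triangle (D.pred s y) y t
        have h6 := perturb_pos c (D.pred s y, y)
        have hu : D.On (s, t) (D.pred s y) := by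
          simp only [GeodesicSystem.On] at hy ⊢
          omega
        obtain ⟨l, hl, hle⟩ := ih _ (by omega) _ hu rfl
        refine ⟨l ++ [y], hl.snoc (hF y hy hsy.symm), ?_⟩
        obtain ⟨k, hk⟩ := Nat.exists_eq_succ_of_ne_zero (List.length_pos_iff.2 hl.ne_nil).ne'
        simp only [List.length_append, List.length_singleton, hk, Nat.succ_eq_add_one,
          Nat.add_sub_cancel] at hle ⊢
        rw [add_mul, one_mul]
        omega
    obtain ⟨l, hl, hle⟩ := key t (by simp [GeodesicSystem.On, D.d_self])
    refine ⟨l, hl, fun l' hl' => le_trans ?_ (hmin l' hl')⟩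
    have := lt_of_mul_lt_mul_right (hle.trans_lt hd1) (Nat.zero_le _)
    omega

theorem exists_isExactPreserver_card_le [Fintype V] {G : WDigraph V} (hG : G.Unweighted)
    (P : Finset (V × V)) (hP : ∀ q ∈ P, G.Reachable q.1 q.2) :
    ∃ F : Finset (V × V), G.IsExactPreserver F P ∧
      (#F : ℝ) ≤ 64 * ((Fintype.card V : ℝ) ^ ((5 : ℝ) / 6) * (#P : ℝ) ^ ((2 : ℝ) / 3)
        + Fintype.card V) := by
  classical
  obtain ⟨D, hD⟩ := exists_geodesicSystem G.Edge
  set F : Finset (V × V) :=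
    {e | ∃ q ∈ P, D.On q e.2 ∧ e.2 ≠ q.1 ∧ e.1 = D.pred q.1 e.2}
  have howner : ∀ e ∈ F, ∃ q ∈ P, D.On q e.2 ∧ e.2 ≠ q.1 ∧ e.1 = D.pred q.1 e.2 :=
    fun e he => (Finset.mem_filter_univ e).1 he
  have hFE : F ⊆ G.Edge := by
    rintro ⟨u, y⟩ he
    obtain ⟨q, hq, h1, h2, h3⟩ := howner _ he
    simp only at h1 h2 h3
    rw [h3]
    exact (hD q.1 q.2 (hP q hq)).1 y h1 h2
  refine ⟨F, ⟨hFE, fun q hq => ?_⟩, ?_⟩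
  · obtain ⟨l, hl, hmin⟩ := (hD q.1 q.2 (hP q hq)).2 F fun y hy hyq =>
      (Finset.mem_filter_univ _).2 ⟨q, hq, hy, hyq, rfl⟩
    exact ⟨⟨l, hl⟩, hG.distOn_eq hFE hl hmin⟩
  · choose! o ho using howner
    have hcard : #(F.image fun e => (e.2, o e)) = #F := by
      refine Finset.card_image_of_injOn fun e he e' he' h => ?_
      simp only [Prod.mk.injEq] at h
      refine Prod.ext ?_ h.1
      rw [(ho e he).2.2.2, (ho e' he').2.2.2, h.1, h.2]
    have hinc : D.IsIncidence (F.image fun e => (e.2, o e)) := by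
      constructor
      · intro y q h
        obtain ⟨e, he, h⟩ := Finset.mem_image.1 h
        simp only [Prod.mk.injEq] at h
        obtain ⟨rfl, rfl⟩ := h
        exact (ho e he).2.1
      · intro y q q' h h' hne hpred
        obtain ⟨e, he, h⟩ := Finset.mem_image.1 h
        obtain ⟨e', he', h'⟩ := Finset.mem_image.1 h'
        simp only [Prod.mk.injEq] at h h'
        obtain ⟨rfl, rfl⟩ := h
        obtain ⟨h2, rfl⟩ := h'
        refine hne (congrArg o (Prod.ext ?_ h2.symm))
        rw [(ho e he).2.2.2, (ho e' he').2.2.2, h2, hpred]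
    rw [← hcard]
    refine hinc.card_le_real fun x hx => ?_
    obtain ⟨e, he, rfl⟩ := Finset.mem_image.1 hx
    exact (ho e he).1

end Digraph

/-- exact distance preservers of size
`O(n^{5/6} p^{2/3} polylog(n) + n)` in directed unweighted graphs. -/
theorem exact_preserver_unweighted_upper_bound :
    ∃ C : ℝ, 1 ≤ C ∧
      ∀ n : ℕ, 2 ≤ n →
      ∀ (V : Type) [Fintype V] (G : WDigraph V),
        Fintype.card V = n → G.Unweighted →
        ∀ P : Finset (V × V), (∀ q ∈ P, G.Reachable q.1 q.2) →
          ∃ F : Finset (V × V), G.IsExactPreserver F P ∧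
            (F.card : ℝ) ≤
              C * ((n : ℝ) ^ ((5 : ℝ) / 6) * (P.card : ℝ) ^ ((2 : ℝ) / 3) *
                Real.log (n : ℝ) ^ (C : ℝ) + (n : ℝ)) := by
  refine ⟨64, by norm_num, fun n hn V _ G hV hG P hP => ?_⟩
  obtain ⟨F, hF, hcard⟩ := exists_isExactPreserver_card_le hG P hP
  refine ⟨F, hF, ?_⟩
  rw [hV] at hcard
  have hX : (0 : ℝ) ≤ (n : ℝ) ^ ((5 : ℝ) / 6) * (#P : ℝ) ^ ((2 : ℝ) / 3) := by positivity
  rcases hn.eq_or_lt with rfl | hn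
  · have h1 : #F ≤ 4 := by simpa [hV] using Finset.card_le_univ F
    have h2 : (#F : ℝ) ≤ 4 := by exact_mod_cast h1
    have h3 : (0 : ℝ) ≤ Real.log ((2 : ℕ) : ℝ) ^ (64 : ℝ) :=
      Real.rpow_nonneg (Real.log_natCast_nonneg 2) _
    have h4 := mul_nonneg hX h3
    push_cast at h4 ⊢
    linarith
  · have h3 : (3 : ℝ) ≤ n := by exact_mod_cast hn
    have hlog : (1 : ℝ) ≤ Real.log n := by
      rw [Real.le_log_iff_exp_le (by linarith)]
      exact Real.exp_one_lt_three.le.trans h3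
    have hpow : (1 : ℝ) ≤ Real.log n ^ (64 : ℝ) := Real.one_le_rpow hlog (by norm_num)
    have := le_mul_of_one_le_right hX hpow
    linarith
end

section
/- There is a constant c > 0 such that for all sufficiently large n, every integer p with n^{1/2} ≤ p ≤ n^2, and every real α ≥ 1, there exist an n-vertex directed positively weighted graph G and a set P of p demand pairs in the transitive closure of G such that every α-approximate distance preserver of (G,P) has at least c·n^{2/3}·p^{2/3} edges. -/
open Finset

/-- `F` is (the edge set of) an `α`-approximate distance preserver of `(G, P)`. -/
def IsApproxPreserver {V : Type} (G : WDigraph V) (F : Finset (V × V))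
    (P : Finset (V × V)) (α : ℝ) : Prop :=
  F ⊆ G.Edge ∧ ∀ q ∈ P, ReachableOn F q.1 q.2 ∧ G.distOn F q.1 q.2 ≤ α * G.dist q.1 q.2

namespace WDigraph

variable {V : Type}

/-- A walk leaving a vertex set `S` weighs at least as much as the lightest edge leaving `S`. -/
lemma le_walkWeight_of_cut (G : WDigraph V) (hw : ∀ e, 0 ≤ G.w e) (F : Finset (V × V))
    (S : V → Prop) (B : ℝ)
    (hcut : ∀ u v, (u, v) ∈ F → S u → ¬ S v → B ≤ G.w (u, v)) (t : V) (ht : ¬ S t) :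
    ∀ (l : List V) (s : V), S s → IsWalkOn F s t l → B ≤ G.walkWeight l := by
  intro l
  induction l with
  | nil => intro s _ h; simp [IsWalkOn] at h
  | cons a l ih =>
    intro s hs h
    obtain ⟨hc, hh, hl⟩ := h
    have has : a = s := by simpa using hh
    subst has
    cases l with
    | nil =>
      have : a = t := by simpa using hl
      exact absurd (this ▸ hs) ht
    | cons b l =>
      have hc' := List.isChain_cons_cons.mp hc
      have hsum : G.walkWeight (a :: b :: l) = G.w (a, b) + G.walkWeight (b :: l) := by
        simp [walkWeight]
      rw [hsum]
      by_cases hb : S b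
      · have := ih b hb ⟨hc'.2, rfl, by simpa using hl⟩
        linarith [hw (a, b)]
      · have h1 := hcut a b hc'.1 hs hb
        have h2 : 0 ≤ G.walkWeight (b :: l) :=
          List.sum_nonneg fun x hx => by
            obtain ⟨e, _, rfl⟩ := List.mem_map.mp hx
            exact hw e
        linarith

lemma exists_walk_le (G : WDigraph V) (F : Finset (V × V)) (C : ℝ) (k : ℕ) :
    ∀ f : ℕ → V, (∀ i < k, (f i, f (i + 1)) ∈ F ∧ G.w (f i, f (i + 1)) ≤ C) →
      ∃ l, IsWalkOn F (f 0) (f k) l ∧ G.walkWeight l ≤ k * C := by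
  induction k with
  | zero => intro f _; exact ⟨[f 0], ⟨List.isChain_singleton _, rfl, rfl⟩, by simp [walkWeight]⟩
  | succ k ih =>
    intro f hf
    obtain ⟨l, ⟨hc, hh, hl⟩, hwt⟩ := ih (fun i => f (i + 1)) fun i hi => hf (i + 1) (by omega)
    cases l with
    | nil => simp at hh
    | cons a l =>
      have ha : a = f 1 := by simpa using hh
      subst ha
      have h0 := hf 0 (by omega)
      refine ⟨f 0 :: f 1 :: l, ⟨List.isChain_cons_cons.mpr ⟨h0.1, hc⟩, rfl, by simpa using hl⟩, ?_⟩
      have hsum : G.walkWeight (f 0 :: f 1 :: l) = G.w (f 0, f 1) + G.walkWeight (f 1 :: l) := by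
        simp [walkWeight]
      rw [hsum]
      push_cast
      linarith [h0.2]

lemma distOn_le (G : WDigraph V) (hw : ∀ e, 0 ≤ G.w e) {F : Finset (V × V)} {s t : V} {l : List V}
    (h : IsWalkOn F s t l) : G.distOn F s t ≤ G.walkWeight l := by
  refine csInf_le ⟨0, ?_⟩ ⟨l, h, rfl⟩
  rintro _ ⟨l, _, rfl⟩
  refine List.sum_nonneg fun x hx => ?_
  obtain ⟨e, _, rfl⟩ := List.mem_map.mp hx
  exact hw e

/-- The complete digraph on `Fin n`, whose vertex `v` is thought of as the grid point
`(v % A, v / A)`. An edge of slope `d ≥ 0` between consecutive columns has weight `W ^ d`;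
every other edge has weight `W ^ n`. -/
noncomputable def slopeGraph (n A : ℕ) (W : ℝ) : WDigraph (Fin n) where
  Edge := univ
  w e :=
    if (e.2 : ℕ) % A = (e.1 : ℕ) % A + 1 ∧ (e.1 : ℕ) / A ≤ (e.2 : ℕ) / A then
      W ^ ((e.2 : ℕ) / A - (e.1 : ℕ) / A)
    else W ^ n

end WDigraph

/-- The vertex of `slopeGraph n A W` in column `i` on the line of slope `m` and intercept `b`. -/
def linePoint (n A : ℕ) [NeZero n] (m b i : ℕ) : Fin n :=
  Fin.ofNat n ((b + m * i) * A + i)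

lemma linePoint_mod_div {n A M m b i : ℕ} [NeZero n] (hn : 2 * A ^ 2 * M ≤ n) (hm : m < M)
    (hb : b < A * M) (hi : i < A) :
    (linePoint n A m b i : ℕ) % A = i ∧ (linePoint n A m b i : ℕ) / A = b + m * i := by
  have h1 : m * i + 1 ≤ A * M := by nlinarith
  have hlt : (b + m * i) * A + i < n := by nlinarith
  have hv : (linePoint n A m b i : ℕ) = i + A * (b + m * i) := by
    simp only [linePoint, Fin.val_ofNat]
    rw [Nat.mod_eq_of_lt hlt]
    ring
  rw [hv]
  exact ⟨by rw [Nat.add_mul_mod_self_left, Nat.mod_eq_of_lt hi],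
    by rw [Nat.add_mul_div_left _ _ (by omega), Nat.div_eq_of_lt hi, zero_add]⟩

lemma Fin.eq_of_mod_div {n A : ℕ} {u v : Fin n} (h1 : (u : ℕ) % A = (v : ℕ) % A)
    (h2 : (u : ℕ) / A = (v : ℕ) / A) : u = v := by
  apply Fin.ext
  rw [← Nat.mod_add_div (u : ℕ) A, ← Nat.mod_add_div (v : ℕ) A, h1, h2]

/-- Preserving the endpoints of a line up to a factor `α` forces every edge of that line. -/
lemma line_edge_mem {n A M m b i : ℕ} [NeZero n] {α : ℝ} (hα : 1 ≤ α) (hn : 2 * A ^ 2 * M ≤ n)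
    (hm : m < M) (hb : b < A * M) (hi : i + 1 < A) {F : Finset (Fin n × Fin n)}
    (hr : ReachableOn F (linePoint n A m b 0) (linePoint n A m b (A - 1)))
    (hd : (WDigraph.slopeGraph n A (α * n + 1)).distOn F
        (linePoint n A m b 0) (linePoint n A m b (A - 1)) ≤
      α * (WDigraph.slopeGraph n A (α * n + 1)).dist
        (linePoint n A m b 0) (linePoint n A m b (A - 1))) :
    (linePoint n A m b i, linePoint n A m b (i + 1)) ∈ F := by
  by_contra he
  set W : ℝ := α * n + 1 with hW
  set G := WDigraph.slopeGraph n A W with hG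
  have hW1 : 1 ≤ W := by
    have : 0 ≤ α * n := by positivity
    linarith
  have hw : ∀ e, 0 ≤ G.w e := by
    intro e
    simp only [hG, WDigraph.slopeGraph]
    split_ifs <;> positivity
  have hpt : ∀ j, j < A → _ := fun j hj => linePoint_mod_div (b := b) hn hm hb hj
  have hAM : A ≤ n ∧ M ≤ n := by
    constructor <;> nlinarith [Nat.mul_le_mul (show 2 ≤ A by omega) (show 1 ≤ M by omega)]
  have hupper : G.dist (linePoint n A m b 0) (linePoint n A m b (A - 1)) ≤
      ((A - 1 : ℕ) : ℝ) * W ^ m := by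
    obtain ⟨l, hl, hlw⟩ := G.exists_walk_le G.Edge (W ^ m) (A - 1) (linePoint n A m b) (by
      intro j hj
      refine ⟨by simp [hG, WDigraph.slopeGraph], ?_⟩
      obtain ⟨h1, h2⟩ := hpt j (by omega)
      obtain ⟨h3, h4⟩ := hpt (j + 1) (by omega)
      have h5 : b + m * (j + 1) - (b + m * j) = m := by
        rw [mul_add, mul_one]; omega
      simp only [hG, WDigraph.slopeGraph, h1, h2, h3, h4, h5]
      rw [if_pos ⟨trivial, by nlinarith⟩])
    exact (G.distOn_le hw hl).trans hlw
  have hlower : W ^ (m + 1) ≤ G.distOn F (linePoint n A m b 0) (linePoint n A m b (A - 1)) := by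
    obtain ⟨l₀, hl₀⟩ := hr
    refine le_csInf ⟨_, l₀, hl₀, rfl⟩ ?_
    rintro _ ⟨l, hl, rfl⟩
    refine G.le_walkWeight_of_cut hw F (fun v => (v : ℕ) / A < b + m * ((v : ℕ) % A) ∨
      ((v : ℕ) / A = b + m * ((v : ℕ) % A) ∧ (v : ℕ) % A ≤ i)) _ ?_ _ ?_ l _ ?_ hl
    · intro u v huv hu hv
      simp only [hG, WDigraph.slopeGraph]
      split_ifs with hs
      · obtain ⟨hx, hy⟩ := hs
        refine pow_le_pow_right₀ hW1 ?_
        by_contra! hlt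
        rw [hx, mul_add, mul_one] at hv
        have hu' : (u : ℕ) / A = b + m * ((u : ℕ) % A) := by omega
        have hxi : (u : ℕ) % A = i := by omega
        have hv' : (v : ℕ) / A = b + m * (i + 1) := by
          rw [mul_add, mul_one, ← hxi]; omega
        obtain ⟨h1, h2⟩ := hpt i (by omega)
        obtain ⟨h3, h4⟩ := hpt (i + 1) hi
        refine he ?_
        rw [← Fin.eq_of_mod_div (hxi.trans h1.symm) ((hxi ▸ hu').trans h2.symm),
          ← Fin.eq_of_mod_div ((hx.trans (by rw [hxi])).trans h3.symm) (hv'.trans h4.symm)]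
        exact huv
      · exact pow_le_pow_right₀ hW1 (by omega)
    · obtain ⟨h1, h2⟩ := hpt (A - 1) (by omega)
      simp only [h1, h2]
      omega
    · obtain ⟨h1, h2⟩ := hpt 0 (by omega)
      simp only [h1, h2]
      simp
  have hA : ((A - 1 : ℕ) : ℝ) ≤ n := by exact_mod_cast (by omega : A - 1 ≤ n)
  have hWm : 0 < W ^ m := by positivity
  have hfin : W ^ (m + 1) ≤ α * (n * W ^ m) :=
    hlower.trans <| hd.trans <| mul_le_mul_of_nonneg_left
      (hupper.trans (mul_le_mul_of_nonneg_right hA hWm.le)) (by linarith)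
  rw [pow_succ] at hfin
  nlinarith

/-- The slope graph gives a lower bound of `(A - 1) * A * M ^ 2` edges. -/
lemma exists_digraph_forcing_edges {n p A M : ℕ} {α : ℝ} (hα : 1 ≤ α) (hA : 2 ≤ A) (hM : 1 ≤ M)
    (hn : 2 * A ^ 2 * M ≤ n) (hp : A * M ^ 2 ≤ p) (hpn : p ≤ n ^ 2) :
    ∃ G : WDigraph (Fin n), G.PosWeights ∧
      ∃ P : Finset (Fin n × Fin n), P.card = p ∧ (∀ q ∈ P, G.Reachable q.1 q.2) ∧
        ∀ F : Finset (Fin n × Fin n), IsApproxPreserver G F P α →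
          (A - 1) * (A * M ^ 2) ≤ F.card := by
  have hn0 : 0 < n := by
    have : 0 < 2 * A ^ 2 * M := by positivity
    omega
  have : NeZero n := ⟨hn0.ne'⟩
  let lines : Finset (ℕ × ℕ) := range M ×ˢ range (A * M)
  let P₀ : Finset (Fin n × Fin n) :=
    lines.image fun q => (linePoint n A q.1 q.2 0, linePoint n A q.1 q.2 (A - 1))
  have hlines : lines.card = A * M ^ 2 := by
    simp only [lines, card_product, card_range]; ring
  have hP₀ : P₀.card ≤ p := card_image_le.trans (hlines.le.trans hp)
  obtain ⟨P, hPP, -, hPc⟩ := exists_subsuperset_card_eq (subset_univ P₀) hP₀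
    (by simpa [sq] using hpn)
  refine ⟨WDigraph.slopeGraph n A (α * n + 1), ?_, P, hPc, ?_, ?_⟩
  · intro e _
    simp only [WDigraph.slopeGraph]
    split_ifs <;> positivity
  · intro q _
    exact ⟨[q.1, q.2], List.isChain_pair.mpr (mem_univ _), rfl, rfl⟩
  · rintro F ⟨-, hF⟩
    have hcard : (range (A - 1) ×ˢ lines).card = (A - 1) * (A * M ^ 2) := by
      rw [card_product, hlines, card_range]
    rw [← hcard]
    refine card_le_card_of_injOn
      (fun r => (linePoint n A r.2.1 r.2.2 r.1, linePoint n A r.2.1 r.2.2 (r.1 + 1))) ?_ ?_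
    · rintro ⟨i, m, b⟩ hr
      simp only [lines, coe_product, Set.mem_prod, mem_coe, mem_range] at hr
      obtain ⟨hi, hm, hb⟩ := hr
      have hq := hF _ (hPP (mem_image_of_mem _
        (show (m, b) ∈ lines from mem_product.mpr ⟨mem_range.mpr hm, mem_range.mpr hb⟩)))
      exact line_edge_mem hα hn hm hb (by omega) hq.1 hq.2
    · rintro ⟨i, m, b⟩ hr ⟨i', m', b'⟩ hr' heq
      simp only [lines, coe_product, Set.mem_prod, mem_coe, mem_range] at hr hr'
      obtain ⟨hi, hm, hb⟩ := hr
      obtain ⟨hi', hm', hb'⟩ := hr'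
      simp only [Prod.mk.injEq] at heq
      obtain ⟨h1, h2⟩ := linePoint_mod_div hn hm hb (show i < A by omega)
      obtain ⟨h3, h4⟩ := linePoint_mod_div hn hm hb (show i + 1 < A by omega)
      obtain ⟨h1', h2'⟩ := linePoint_mod_div hn hm' hb' (show i' < A by omega)
      obtain ⟨h3', h4'⟩ := linePoint_mod_div hn hm' hb' (show i' + 1 < A by omega)
      rw [heq.1] at h1 h2
      rw [heq.2] at h3 h4
      have hii : i = i' := h1.symm.trans h1'
      subst hii
      have e1 := h2.symm.trans h2'
      have e2 := h4.symm.trans h4'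
      rw [mul_add, mul_add, mul_one, mul_one] at e2
      have hmm : m = m' := by omega
      subst hmm
      have hbb : b = b' := by omega
      rw [hbb]

/-- Integer grid dimensions adapted to `n = u ^ 3` vertices and `p = v ^ 3` pairs. -/
lemma exists_grid_dimensions {n p : ℕ} {u v : ℝ} (hu : 0 < u) (hv : 0 < v) (hun : u ^ 3 = n)
    (hvp : v ^ 3 = p) (huv : u ≤ v ^ 2) (hvu : v ≤ u ^ 2) (hn : 1152 ≤ n) :
    ∃ A M : ℕ, 2 ≤ A ∧ 1 ≤ M ∧ 2 * A ^ 2 * M ≤ n ∧ A * M ^ 2 ≤ p ∧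
      u * v / 144 ≤ (A : ℝ) * M := by
  obtain ⟨a, ha⟩ : ∃ a, a = u ^ 2 / v := ⟨_, rfl⟩
  obtain ⟨m, hm⟩ : ∃ m, m = v ^ 2 / u := ⟨_, rfl⟩
  have ha1 : 1 ≤ a := by rw [ha, one_le_div hv]; exact hvu
  have hm1 : 1 ≤ m := by rw [hm, one_le_div hu]; exact huv
  have hn' : a ^ 2 * m = n := by rw [← hun, ha, hm]; field_simp
  have hp' : a * m ^ 2 = p := by rw [← hvp, ha, hm]; field_simp
  have ham : u * v = a * m := by rw [ha, hm]; field_simp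
  rw [ham]
  rcases le_or_gt 18 m with h | h
  · refine ⟨⌈a⌉₊ + 1, ⌊m / 18⌋₊, ?_, ?_, ?_, ?_, ?_⟩
    · have : 0 < ⌈a⌉₊ := Nat.ceil_pos.mpr (by linarith)
      omega
    · exact Nat.le_floor (by push_cast; linarith)
    all_goals
      have h1 : ((⌈a⌉₊ + 1 : ℕ) : ℝ) ≤ 3 * a := by
        push_cast
        linarith [Nat.ceil_lt_add_one (show 0 ≤ a by linarith)]
      have h2 : a ≤ ((⌈a⌉₊ + 1 : ℕ) : ℝ) := by
        push_cast
        linarith [Nat.le_ceil a]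
      have h3 : (⌊m / 18⌋₊ : ℝ) ≤ m / 18 := Nat.floor_le (by linarith)
      have h4 : m / 36 ≤ (⌊m / 18⌋₊ : ℝ) := by
        have h5 := Nat.lt_floor_add_one (m / 18)
        have h6 : (1 : ℝ) ≤ (⌊m / 18⌋₊ : ℝ) := by
          exact_mod_cast Nat.le_floor (by push_cast; linarith)
        linarith
      generalize ⌈a⌉₊ + 1 = A at *
      generalize ⌊m / 18⌋₊ = M at *
    · have : 2 * (A : ℝ) ^ 2 * M ≤ (n : ℝ) := by
        calc 2 * (A : ℝ) ^ 2 * M ≤ 2 * (3 * a) ^ 2 * (m / 18) := by gcongr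
          _ = (n : ℝ) := by rw [← hn']; ring
      exact_mod_cast this
    · have : (A : ℝ) * M ^ 2 ≤ p := by
        calc (A : ℝ) * M ^ 2 ≤ (3 * a) * (m / 18) ^ 2 := by gcongr
          _ = a * m ^ 2 / 108 := by ring
          _ ≤ p := by rw [← hp']; exact div_le_self (by positivity) (by norm_num)
      exact_mod_cast this
    · calc a * m / 144 ≤ a * m / 36 := by gcongr; norm_num
        _ = a * (m / 36) := by ring
        _ ≤ A * M := by gcongr
  · have ha8 : 8 ≤ a := by
      by_contra! hlt
      have h1152 : (1152 : ℝ) ≤ n := by exact_mod_cast hn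
      have : a ^ 2 * m < 8 ^ 2 * 18 := by
        gcongr
      rw [hn'] at this
      linarith
    have h1 : (⌊a / 4⌋₊ : ℝ) ≤ a / 4 := Nat.floor_le (by linarith)
    have h2 : a / 8 ≤ (⌊a / 4⌋₊ : ℝ) := by
      linarith [Nat.lt_floor_add_one (a / 4)]
    refine ⟨⌊a / 4⌋₊, 1, Nat.le_floor (by push_cast; linarith), le_rfl, ?_, ?_, ?_⟩
    · have : 2 * (⌊a / 4⌋₊ : ℝ) ^ 2 * 1 ≤ n := by
        calc 2 * (⌊a / 4⌋₊ : ℝ) ^ 2 * 1 ≤ 2 * (a / 4) ^ 2 * m := by gcongr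
          _ = a ^ 2 * m / 8 := by ring
          _ ≤ n := by rw [← hn']; exact div_le_self (by positivity) (by norm_num)
      exact_mod_cast this
    · have : (⌊a / 4⌋₊ : ℝ) * 1 ^ 2 ≤ p := by
        calc (⌊a / 4⌋₊ : ℝ) * 1 ^ 2 ≤ (a / 4) * m ^ 2 := by gcongr
          _ = a * m ^ 2 / 4 := by ring
          _ ≤ p := by rw [← hp']; exact div_le_self (by positivity) (by norm_num)
      exact_mod_cast this
    · calc a * m / 144 ≤ a * 18 / 144 := by gcongr
        _ = a / 8 := by ring
        _ ≤ ⌊a / 4⌋₊ * (1 : ℕ) := by simpa using h2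

/-- `Ω(n^{2/3} p^{2/3})` lower bound for α-approximate distance preservers
in directed weighted graphs, for any finite stretch α. -/
theorem approx_preserver_lower_bound :
    ∃ c : ℝ, 0 < c ∧ ∃ N : ℕ, ∀ n : ℕ, N ≤ n →
      ∀ p : ℕ, (n : ℝ) ^ ((1 : ℝ) / 2) ≤ (p : ℝ) → (p : ℝ) ≤ (n : ℝ) ^ 2 →
      ∀ α : ℝ, 1 ≤ α →
        ∃ G : WDigraph (Fin n), G.PosWeights ∧
          ∃ P : Finset (Fin n × Fin n), P.card = p ∧ (∀ q ∈ P, G.Reachable q.1 q.2) ∧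
            ∀ F : Finset (Fin n × Fin n), IsApproxPreserver G F P α →
              c * (n : ℝ) ^ ((2 : ℝ) / 3) * (p : ℝ) ^ ((2 : ℝ) / 3) ≤ (F.card : ℝ) := by
  refine ⟨1 / 41472, by norm_num, 1152, fun n hn p hnp hpn α hα => ?_⟩
  have hn0 : (0 : ℝ) < n := by exact_mod_cast (by omega : 0 < n)
  have hp0 : (0 : ℝ) < p := (Real.rpow_pos_of_pos hn0 _).trans_le hnp
  have hroot : ∀ x : ℝ, 0 < x → (x ^ ((1 : ℝ) / 3)) ^ 3 = x := fun x hx => by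
    rw [← Real.rpow_natCast, ← Real.rpow_mul hx.le]
    norm_num
  have hsq : ∀ x : ℝ, 0 < x → x ^ ((2 : ℝ) / 3) = (x ^ ((1 : ℝ) / 3)) ^ 2 := fun x hx => by
    rw [← Real.rpow_natCast, ← Real.rpow_mul hx.le]
    norm_num
  rw [hsq n hn0, hsq p hp0]
  have hu := Real.rpow_pos_of_pos hn0 ((1 : ℝ) / 3)
  have hv := Real.rpow_pos_of_pos hp0 ((1 : ℝ) / 3)
  have hun := hroot n hn0
  have hvp := hroot p hp0
  generalize (n : ℝ) ^ ((1 : ℝ) / 3) = u at *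
  generalize (p : ℝ) ^ ((1 : ℝ) / 3) = v at *
  have hnp2 : (n : ℝ) ≤ (p : ℝ) ^ 2 := by
    rw [← Real.sqrt_eq_rpow] at hnp
    exact (Real.sqrt_le_left hp0.le).mp hnp
  have huv : u ≤ v ^ 2 := by
    refine le_of_pow_le_pow_left₀ (n := 3) (by norm_num) (by positivity) ?_
    calc u ^ 3 ≤ (v ^ 3) ^ 2 := by rw [hun, hvp]; exact hnp2
      _ = (v ^ 2) ^ 3 := by ring
  have hvu : v ≤ u ^ 2 := by
    refine le_of_pow_le_pow_left₀ (n := 3) (by norm_num) (by positivity) ?_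
    calc v ^ 3 ≤ (u ^ 3) ^ 2 := by rw [hun, hvp]; exact hpn
      _ = (u ^ 2) ^ 3 := by ring
  obtain ⟨A, M, hA, hM, hAn, hAp, hAM⟩ := exists_grid_dimensions hu hv hun hvp huv hvu hn
  obtain ⟨G, hG, P, hPc, hPr, hF⟩ :=
    exists_digraph_forcing_edges hα hA hM hAn hAp (by exact_mod_cast hpn)
  refine ⟨G, hG, P, hPc, hPr, fun F hFP => ?_⟩
  have hcard : ((A - 1 : ℕ) : ℝ) * (A * M ^ 2) ≤ F.card := by exact_mod_cast hF F hFP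
  have hA2 : (A : ℝ) / 2 ≤ ((A - 1 : ℕ) : ℝ) := by
    have : (2 : ℝ) ≤ A := by exact_mod_cast hA
    rw [Nat.cast_sub (by omega)]
    push_cast
    linarith
  calc 1 / 41472 * u ^ 2 * v ^ 2 = (u * v / 144) ^ 2 / 2 := by ring
    _ ≤ ((A : ℝ) * M) ^ 2 / 2 := by gcongr
    _ = (A : ℝ) / 2 * (A * M ^ 2) := by ring
    _ ≤ ((A - 1 : ℕ) : ℝ) * (A * M ^ 2) := by gcongr
    _ ≤ F.card := hcard
end
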